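/- If a term t of the star combinatory calculus for arithmetic is reducible and t ⪰ q (t reduces to q by finitely many one-step reductions), then q is reducible. -/

import Mathlib

namespace StarArith

/-- Finite types over the ground type `N`, closed under `→` and `*`. -/
inductive Ty : Type where
  | ground : Ty          -- the type `N` of natural numbers
  | arrow : Ty → Ty → Ty
  | star : Ty → Ty
deriving DecidableEq, Repr

/-- Terms of the star combinatory calculus for arithmetic. -/
inductive ATerm : Ty → Type where
  | var (n : ℕ) (σ : Ty) : ATerm σ
  | zero : ATerm .ground
  | succ : ATerm (Ty.ground.arrow .ground)
  | recr (σ : Ty) :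
      ATerm (Ty.ground.arrow (σ.arrow ((σ.arrow (Ty.ground.arrow σ)).arrow σ)))
  | pi (σ τ : Ty) : ATerm (σ.arrow (τ.arrow σ))
  | sigma (ρ σ τ : Ty) :
      ATerm ((ρ.arrow (σ.arrow τ)).arrow ((ρ.arrow σ).arrow (ρ.arrow τ)))
  | sing (σ : Ty) : ATerm (σ.arrow σ.star)
  | union (σ : Ty) : ATerm (σ.star.arrow (σ.star.arrow σ.star))
  | bigUnion (σ τ : Ty) : ATerm (σ.star.arrow ((σ.arrow τ.star).arrow τ.star))
  | app {σ τ : Ty} (t : ATerm (σ.arrow τ)) (q : ATerm σ) : ATerm τ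

/-- One-step reduction: apply one of the conversions
`Σtqr ⇝ tr(qr)`, `Πtq ⇝ t`, `⋃(𝔰t)q ⇝ qt`, `⋃(∪tq)r ⇝ ∪(⋃tr)(⋃qr)`,
`R0qr ⇝ q`, `R(St)qr ⇝ r(Rtqr)t` to a subterm. -/
inductive Step : {σ : Ty} → ATerm σ → ATerm σ → Prop where
  | sigma {ρ σ τ : Ty} (t : ATerm (ρ.arrow (σ.arrow τ))) (q : ATerm (ρ.arrow σ))
      (r : ATerm ρ) :
      Step ((((ATerm.sigma ρ σ τ).app t).app q).app r) ((t.app r).app (q.app r))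
  | pi {σ τ : Ty} (t : ATerm σ) (q : ATerm τ) :
      Step (((ATerm.pi σ τ).app t).app q) t
  | bigUnion_sing {σ τ : Ty} (t : ATerm σ) (q : ATerm (σ.arrow τ.star)) :
      Step (((ATerm.bigUnion σ τ).app ((ATerm.sing σ).app t)).app q) (q.app t)
  | bigUnion_union {σ τ : Ty} (t q : ATerm σ.star) (r : ATerm (σ.arrow τ.star)) :
      Step (((ATerm.bigUnion σ τ).app (((ATerm.union σ).app t).app q)).app r)
        (((ATerm.union τ).app (((ATerm.bigUnion σ τ).app t).app r)).app
          (((ATerm.bigUnion σ τ).app q).app r))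
  | rec_zero {σ : Ty} (q : ATerm σ) (r : ATerm (σ.arrow (Ty.ground.arrow σ))) :
      Step ((((ATerm.recr σ).app .zero).app q).app r) q
  | rec_succ {σ : Ty} (t : ATerm .ground) (q : ATerm σ)
      (r : ATerm (σ.arrow (Ty.ground.arrow σ))) :
      Step ((((ATerm.recr σ).app (ATerm.succ.app t)).app q).app r)
        ((r.app ((((ATerm.recr σ).app t).app q).app r)).app t)
  | app_left {σ τ : Ty} {t t' : ATerm (σ.arrow τ)} (q : ATerm σ) :
      Step t t' → Step (t.app q) (t'.app q)
  | app_right {σ τ : Ty} (t : ATerm (σ.arrow τ)) {q q' : ATerm σ} :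
      Step q q' → Step (t.app q) (t.app q')

/-- `t ⪰ q` : `t` reduces to `q` by finitely many (possibly zero) one-step reductions. -/
def Reduces {σ : Ty} (t q : ATerm σ) : Prop :=
  Relation.ReflTransGen Step t q

/-- A term is normal if no one-step reduction applies to it. -/
def Normal {σ : Ty} (t : ATerm σ) : Prop :=
  ∀ q : ATerm σ, ¬ Step t q

/-- A term is strongly normalizable if there is no infinite chain of one-step
reductions starting from it. -/
def SN {σ : Ty} (t : ATerm σ) : Prop :=
  ¬ ∃ f : ℕ → ATerm σ, f 0 = t ∧ ∀ n : ℕ, Step (f n) (f (n + 1))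

/-- A term is closed if it contains no variables. -/
def ATerm.ClosedT : {σ : Ty} → ATerm σ → Prop
  | _, .var _ _ => False
  | _, .app t q => t.ClosedT ∧ q.ClosedT
  | _, _ => True

/-- A term of star type is set-like if it is constructed solely from terms of the
form `𝔰q` and the constant `∪`. -/
inductive SetLike : {σ : Ty} → ATerm σ.star → Prop where
  | sing {σ : Ty} (q : ATerm σ) : SetLike ((ATerm.sing σ).app q)
  | union {σ : Ty} {t₁ t₂ : ATerm σ.star} :
      SetLike t₁ → SetLike t₂ → SetLike (((ATerm.union σ).app t₁).app t₂)

/-- `SMem s t` : `s` is a surface element of the star-type term `t`, i.e. `s ∈ SM(t)`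
where `SM(𝔰q) = {q}`, `SM(∪qr) = SM(q) ∪ SM(r)` and `SM(t) = ∅` otherwise. -/
inductive SMem : {σ : Ty} → ATerm σ → ATerm σ.star → Prop where
  | sing {σ : Ty} (q : ATerm σ) : SMem q ((ATerm.sing σ).app q)
  | unionL {σ : Ty} {s : ATerm σ} {a b : ATerm σ.star} :
      SMem s a → SMem s (((ATerm.union σ).app a).app b)
  | unionR {σ : Ty} {s : ATerm σ} {a b : ATerm σ.star} :
      SMem s b → SMem s (((ATerm.union σ).app a).app b)

/-- Tait-style reducibility, defined by recursion on the type: at ground type `N`,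
reducible = strongly normalizable; at `σ → τ`, `t` is reducible iff `tq` is
reducible for every reducible `q`; at `σ*`, `t` is reducible iff `t` is strongly
normalizable and all surface elements of all terms obtained by reduction of `t` are
reducible. -/
def Red : {σ : Ty} → ATerm σ → Prop
  | .ground, t => SN t
  | .arrow σ _, t => ∀ q : ATerm σ, Red q → Red (t.app q)
  | .star σ, t => SN t ∧ ∀ q : ATerm σ.star, Reduces t q → ∀ s : ATerm σ, SMem s q → Red s

/-- The numeral `S(S(⋯(S0)))` for the natural number `n`. -/
def numeral : ℕ → ATerm .ground
  | 0 => .zero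
  | n + 1 => ATerm.succ.app (numeral n)

end StarArith

namespace StarArith

theorem SN.of_step {σ : Ty} {t q : ATerm σ} (ht : SN t) (h : Step t q) : SN q := by
  rintro ⟨f, rfl, hf⟩
  refine ht ⟨fun n => Nat.casesOn n t f, rfl, fun n => ?_⟩
  cases n with
  | zero => exact h
  | succ n => exact hf n

theorem SN.of_reduces {σ : Ty} {t q : ATerm σ} (ht : SN t) (h : Reduces t q) : SN q := by
  induction h with
  | refl => exact ht
  | tail _ hstep ih => exact ih.of_step hstep

theorem Reduces.app_left {σ τ : Ty} {t q : ATerm (σ.arrow τ)} (h : Reduces t q)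
    (r : ATerm σ) : Reduces (t.app r) (q.app r) :=
  Relation.ReflTransGen.lift (fun s : ATerm (σ.arrow τ) => s.app r)
    (fun _ _ => Step.app_left r) _ _ h

end StarArith

open StarArith in
/-- If a term `t` of the star combinatory calculus for arithmetic
is reducible and `t ⪰ q`, then `q` is reducible. -/
theorem reducible_of_reduces {σ : Ty} {t q : ATerm σ}
    (ht : Red t) (h : Reduces t q) : Red q := by
  induction σ with
  | ground =>
    rw [Red] at ht ⊢
    exact ht.of_reduces h
  | arrow σ τ _ ih =>
    rw [Red] at ht ⊢
    exact fun r hr => ih (ht r hr) (h.app_left r)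
  | star σ _ =>
    rw [Red] at ht ⊢
    exact ⟨ht.1.of_reduces h, fun r hr => ht.2 r (Relation.ReflTransGen.trans h hr)⟩
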